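/- arXiv:math/0603432 — 3 statements merged into one kernel-verified Lean document; each statement's English description precedes it below -/
import Mathlib

section
/- Let ω be a smooth differential 2-form on ℝ⁴. Then the Euler operator annihilates ω, i.e. d(⊥dω) = 0, if and only if there exists a smooth function μ on ℝ⁴ such that ω + μΩ is closed: d(ω + μΩ) = 0. -/
noncomputable section

/-- `ℝ⁴` with coordinates `(q₁, q₂, p₁, p₂) = (x 0, x 1, x 2, x 3)`. -/
abbrev V : Type := Fin 4 → ℝ

/-- The complexification `ℂ⁴`. -/
abbrev Vc : Type := Fin 4 → ℂ

/-- Standard basis of `ℝ⁴`: `e 0 = e_{q₁}`, `e 1 = e_{q₂}`, `e 2 = e_{p₁}`, `e 3 = e_{p₂}`. -/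
def e (i : Fin 4) : V := Pi.single i 1

/-- Standard basis of `ℂ⁴`. -/
def ec (i : Fin 4) : Vc := Pi.single i 1

/-- The standard symplectic form `Ω = dq₁ ∧ dp₁ + dq₂ ∧ dp₂` on `ℝ⁴`. -/
def Omega : V → V → ℝ := fun x y => x 0 * y 2 - x 2 * y 0 + x 1 * y 3 - x 3 * y 1

/-- The complex bilinear extension of `Ω` to `ℂ⁴`. -/
def OmegaC : Vc → Vc → ℂ := fun x y => x 0 * y 2 - x 2 * y 0 + x 1 * y 3 - x 3 * y 1

/-- Predicate: `ω` is an alternating (bilinear and antisymmetric) 2-form on `ℝ⁴`. -/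
structure IsAlt2 (ω : V → V → ℝ) : Prop where
  add_left : ∀ x x' y, ω (x + x') y = ω x y + ω x' y
  smul_left : ∀ (c : ℝ) (x y : V), ω (c • x) y = c * ω x y
  antisymm : ∀ x y, ω x y = - ω y x

/-- Predicate: `θ` is a complex alternating (bilinear and antisymmetric) 2-form on `ℂ⁴`. -/
structure IsAlt2C (θ : Vc → Vc → ℂ) : Prop where
  add_left : ∀ x x' y, θ (x + x') y = θ x y + θ x' y
  smul_left : ∀ (c : ℂ) (x y : Vc), θ (c • x) y = c * θ x y
  antisymm : ∀ x y, θ x y = - θ y x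

section Wedge

variable {W : Type*} {k : Type*} [CommRing k]

/-- Wedge product of two 1-forms. -/
def wedge11 (a b : W → k) : W → W → k := fun x y => a x * b y - a y * b x

/-- Wedge product of a 1-form and a 2-form. -/
def wedge12 (a : W → k) (B : W → W → k) : W → W → W → k :=
  fun x y z => a x * B y z - a y * B x z + a z * B x y

/-- Wedge product of a 1-form and a 3-form. -/
def wedge13 (a : W → k) (C : W → W → W → k) : W → W → W → W → k :=
  fun x y z w => a x * C y z w - a y * C x z w + a z * C x y w - a w * C x y z

/-- Wedge product of a 3-form and a 1-form. -/
def wedge31 (C : W → W → W → k) (a : W → k) : W → W → W → W → k :=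
  fun x y z w => C x y z * a w - C x y w * a z + C x z w * a y - C y z w * a x

/-- Wedge product of two 2-forms. -/
def wedge22 (A B : W → W → k) : W → W → W → W → k :=
  fun x y z w =>
    A x y * B z w - A x z * B y w + A x w * B y z
      + A y z * B x w - A y w * B x z + A z w * B x y

end Wedge

/-- `⊥` of a 2-form on `ℝ⁴`: contraction with the bivector dual to `Ω`. -/
def perpTwo (θ : V → V → ℝ) : ℝ := θ (e 0) (e 2) + θ (e 1) (e 3)

/-- `⊥` of a complex 2-form on `ℂ⁴`. -/
def perpTwoC (θ : Vc → Vc → ℂ) : ℂ := θ (ec 0) (ec 2) + θ (ec 1) (ec 3)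

/-- `⊥` of a 3-form on `ℝ⁴`. -/
def perpThree (θ : V → V → V → ℝ) : V → ℝ := fun x => θ (e 0) (e 2) x + θ (e 1) (e 3) x

/-- A differential 1-form on `ℝ⁴` is smooth if its evaluation against any constant
vector field is smooth. -/
def Smooth1 (α : V → V → ℝ) : Prop := ∀ x, ContDiff ℝ (⊤ : ℕ∞) fun p => α p x

/-- A differential 2-form on `ℝ⁴` is smooth if its evaluations against constant
vector fields are smooth. -/
def Smooth2 (ω : V → V → V → ℝ) : Prop := ∀ x y, ContDiff ℝ (⊤ : ℕ∞) fun p => ω p x y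

/-- Exterior derivative of a differential 0-form (function), evaluated on a constant
vector field. -/
def d0 (f : V → ℝ) : V → V → ℝ := fun p x => fderiv ℝ f p x

/-- Exterior derivative of a differential 1-form, evaluated on constant vector fields. -/
def d1 (α : V → V → ℝ) : V → V → V → ℝ :=
  fun p x y => fderiv ℝ (fun q => α q y) p x - fderiv ℝ (fun q => α q x) p y

/-- Exterior derivative of a differential 2-form, evaluated on constant vector fields. -/
def d2 (ω : V → V → V → ℝ) : V → V → V → V → ℝ :=
  fun p x y z =>
    fderiv ℝ (fun q => ω q y z) p x - fderiv ℝ (fun q => ω q x z) p y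
      + fderiv ℝ (fun q => ω q x y) p z

/-- Exterior derivative of a differential 3-form, evaluated on constant vector fields. -/
def d3 (θ : V → V → V → V → ℝ) : V → V → V → V → V → ℝ :=
  fun p x y z w =>
    fderiv ℝ (fun q => θ q y z w) p x - fderiv ℝ (fun q => θ q x z w) p y
      + fderiv ℝ (fun q => θ q x y w) p z - fderiv ℝ (fun q => θ q x y z) p w

/-- A mixed-degree complex form on `ℝ⁴`, given by its homogeneous components of
degree 0,1,2,3,4 (a degree-`k` component is recorded through its values on `k`-tuples
of complexified vectors). -/
structure Mixed where
  c0 : ℂ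
  c1 : Vc → ℂ
  c2 : Vc → Vc → ℂ
  c3 : Vc → Vc → Vc → ℂ
  c4 : Vc → Vc → Vc → Vc → ℂ

namespace Mixed

instance : Zero Mixed := ⟨⟨0, 0, 0, 0, 0⟩⟩

instance : Add Mixed :=
  ⟨fun A B => ⟨A.c0 + B.c0, A.c1 + B.c1, A.c2 + B.c2, A.c3 + B.c3, A.c4 + B.c4⟩⟩

instance : Neg Mixed := ⟨fun A => ⟨-A.c0, -A.c1, -A.c2, -A.c3, -A.c4⟩⟩

instance : SMul ℂ Mixed :=
  ⟨fun c A => ⟨c * A.c0, c • A.c1, c • A.c2, c • A.c3, c • A.c4⟩⟩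

end Mixed

/-- A complex scalar, seen as a mixed form of degree 0. -/
def scalarM (c : ℂ) : Mixed := ⟨c, 0, 0, 0, 0⟩

/-- A complex 1-form, seen as a mixed form. -/
def oneM (α : Vc → ℂ) : Mixed := ⟨0, α, 0, 0, 0⟩

/-- A complex 2-form, seen as a mixed form. -/
def twoM (θ : Vc → Vc → ℂ) : Mixed := ⟨0, 0, θ, 0, 0⟩

/-- Wedge product of mixed forms (degrees `> 4` vanish on `ℝ⁴`). -/
def wedgeM (A B : Mixed) : Mixed where
  c0 := A.c0 * B.c0
  c1 := fun x => A.c0 * B.c1 x + B.c0 * A.c1 x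
  c2 := fun x y => A.c0 * B.c2 x y + B.c0 * A.c2 x y + wedge11 A.c1 B.c1 x y
  c3 := fun x y z => A.c0 * B.c3 x y z + B.c0 * A.c3 x y z
    + wedge12 A.c1 B.c2 x y z + wedge12 B.c1 A.c2 x y z
  c4 := fun x y z w => A.c0 * B.c4 x y z w + B.c0 * A.c4 x y z w
    + wedge13 A.c1 B.c3 x y z w + wedge31 A.c3 B.c1 x y z w + wedge22 A.c2 B.c2 x y z w

/-- Interior product of a mixed form with a complexified vector `X`. -/
def iotaM (X : Vc) (A : Mixed) : Mixed :=
  ⟨A.c1 X, fun x => A.c2 X x, fun x y => A.c3 X x y, fun x y z => A.c4 X x y z, 0⟩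

/-- The spin (Clifford) action `ρ(X + ξ)(θ) = ι_X θ + ξ ∧ θ` of `X + ξ ∈ (T ⊕ T*) ⊗ ℂ`
on mixed forms. -/
def rhoM (X : Vc) (ξ : Vc → ℂ) (A : Mixed) : Mixed := iotaM X A + wedgeM (oneM ξ) A

/-- Componentwise complex conjugation of a vector in `ℂ⁴`. -/
def cconj (x : Vc) : Vc := fun i => starRingEnd ℂ (x i)

/-- Complex conjugation of a complex 2-form. -/
def conj2 (θ : Vc → Vc → ℂ) : Vc → Vc → ℂ :=
  fun x y => starRingEnd ℂ (θ (cconj x) (cconj y))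

/-- Complex conjugation of a mixed form. -/
def conjM (A : Mixed) : Mixed where
  c0 := starRingEnd ℂ A.c0
  c1 := fun x => starRingEnd ℂ (A.c1 (cconj x))
  c2 := fun x y => starRingEnd ℂ (A.c2 (cconj x) (cconj y))
  c3 := fun x y z => starRingEnd ℂ (A.c3 (cconj x) (cconj y) (cconj z))
  c4 := fun x y z w => starRingEnd ℂ (A.c4 (cconj x) (cconj y) (cconj z) (cconj w))

/-- Complex bilinear extension of a real 1-form on `ℝ⁴` to `ℂ⁴`. -/
def cx1 (α : V → ℝ) : Vc → ℂ := fun x => ∑ i, x i * (α (e i) : ℂ)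

/-- Complex bilinear extension of a real 2-form on `ℝ⁴` to `ℂ⁴`. -/
def cx2 (ω : V → V → ℝ) : Vc → Vc → ℂ := fun x y => ∑ i, ∑ j, x i * y j * (ω (e i) (e j) : ℂ)

/-- `Θ = ω - iΩ`, as a complex 2-form on `ℂ⁴`. -/
def ThetaM (ω : V → V → ℝ) : Vc → Vc → ℂ :=
  fun x y => cx2 ω x y - Complex.I * OmegaC x y

/-- `Φ = exp Θ = 1 + Θ + ½ Θ∧Θ`, as a mixed form. -/
def PhiM (ω : V → V → ℝ) : Mixed :=
  ⟨1, 0, ThetaM ω, 0, fun x y z w => (1 / 2 : ℂ) * wedge22 (ThetaM ω) (ThetaM ω) x y z w⟩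

/-- Lie bracket of two vector fields on `ℝ⁴`. -/
def lieBracket (X Y : V → V) : V → V :=
  fun p => fderiv ℝ Y p (X p) - fderiv ℝ X p (Y p)

/-- The Nijenhuis tensor of a field `J` of endomorphisms of `ℝ⁴`, evaluated on two
vector fields: `N_J(X,Y) = [JX,JY] - J[JX,Y] - J[X,JY] + J²[X,Y]`. -/
def nijenhuis (J : V → (V →ₗ[ℝ] V)) (X Y : V → V) : V → V :=
  fun p =>
    lieBracket (fun q => J q (X q)) (fun q => J q (Y q)) p
      - J p (lieBracket (fun q => J q (X q)) Y p)
      - J p (lieBracket X (fun q => J q (Y q)) p)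
      + J p (J p (lieBracket X Y p))

/-- Predicate: `θ` is an alternating (trilinear and antisymmetric) 3-form on `ℝ⁴`. -/
structure IsAlt3 (θ : V → V → V → ℝ) : Prop where
  add_left : ∀ x x' y z, θ (x + x') y z = θ x y z + θ x' y z
  smul_left : ∀ (c : ℝ) (x y z : V), θ (c • x) y z = c * θ x y z
  antisymm_left : ∀ x y z, θ x y z = - θ y x z
  antisymm_right : ∀ x y z, θ x y z = - θ x z y

lemma IsAlt2.add_right {ω : V → V → ℝ} (h : IsAlt2 ω) (x y y' : V) :
    ω x (y + y') = ω x y + ω x y' := by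
  rw [h.antisymm x, h.add_left, h.antisymm x y, h.antisymm x y']; ring

lemma IsAlt2.smul_right {ω : V → V → ℝ} (h : IsAlt2 ω) (c : ℝ) (x y : V) :
    ω x (c • y) = c * ω x y := by
  rw [h.antisymm x, h.smul_left, h.antisymm x y]; ring

lemma eq_sum_smul_e (x : V) : x = x 0 • e 0 + x 1 • e 1 + x 2 • e 2 + x 3 • e 3 := by
  ext i; fin_cases i <;> simp [e]

lemma IsAlt3.ext_zero {θ : V → V → V → ℝ} (h : IsAlt3 θ)
    (hb : ∀ i j k, θ (e i) (e j) (e k) = 0) (x y z : V) : θ x y z = 0 := by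
  have hx : ∀ y z, (∀ i, θ (e i) y z = 0) → ∀ x, θ x y z = 0 := fun y z hi x => by
    rw [eq_sum_smul_e x]
    simp only [h.add_left, h.smul_left, hi, mul_zero, add_zero]
  refine hx y z (fun i => ?_) x
  rw [h.antisymm_left, neg_eq_zero]
  refine hx _ z (fun j => ?_) y
  rw [h.antisymm_right, h.antisymm_left, neg_neg]
  refine hx _ _ (fun k => ?_) z
  rw [h.antisymm_left, h.antisymm_right, neg_neg, hb]

/-- In dimension four, `⊥` is injective on 3-forms. -/
lemma IsAlt3.eq_zero_of_perpThree_eq_zero {θ : V → V → V → ℝ} (h : IsAlt3 θ)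
    (hp : ∀ x, perpThree θ x = 0) (x y z : V) : θ x y z = 0 := by
  have hl : ∀ x z, θ x x z = 0 := fun x z => by linarith [h.antisymm_left x x z]
  have hr : ∀ x y, θ x y y = 0 := fun x y => by linarith [h.antisymm_right x y y]
  have hm : ∀ x y, θ x y x = 0 := fun x y => by
    rw [h.antisymm_right, hl, neg_zero]
  simp only [perpThree] at hp
  have h021 : θ (e 0) (e 2) (e 1) = 0 := by simpa [hm] using hp (e 1)
  have h023 : θ (e 0) (e 2) (e 3) = 0 := by simpa [hr] using hp (e 3)
  have h130 : θ (e 1) (e 3) (e 0) = 0 := by simpa [hm] using hp (e 0)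
  have h132 : θ (e 1) (e 3) (e 2) = 0 := by simpa [hr] using hp (e 2)
  have key : ∀ {x y z}, θ x y z = 0 → θ x z y = 0 ∧ θ y x z = 0 ∧ θ y z x = 0 ∧
      θ z x y = 0 ∧ θ z y x = 0 := fun {x y z} h0 => by
    have h1 := h.antisymm_left x y z
    have h2 := h.antisymm_right x y z
    have h3 := h.antisymm_right y x z
    have h4 := h.antisymm_left x z y
    have h5 := h.antisymm_left y z x
    refine ⟨?_, ?_, ?_, ?_, ?_⟩ <;> linarith
  refine h.ext_zero (fun i j k => ?_) x y z
  fin_cases i <;> fin_cases j <;> fin_cases k <;>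
    simp [hl, hr, hm, h021, h023, h130, h132, key h021, key h023, key h130, key h132]

lemma Smooth2.differentiableAt {ω : V → V → V → ℝ} (h : Smooth2 ω) (x y p : V) :
    DifferentiableAt ℝ (fun q => ω q x y) p :=
  (h x y).differentiable (by simp) p

/-- The derivative of a differential 2-form in a fixed direction is again a 2-form. -/
lemma isAlt2_fderiv {ω : V → V → V → ℝ} (halt : ∀ p, IsAlt2 (ω p)) (hsm : Smooth2 ω) (p v : V) :
    IsAlt2 fun x y => fderiv ℝ (fun q => ω q x y) p v where
  add_left x x' y := by
    simp only [(halt _).add_left]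
    rw [fderiv_fun_add (hsm.differentiableAt _ _ p) (hsm.differentiableAt _ _ p)]
    rfl
  smul_left c x y := by
    simp only [(halt _).smul_left]
    rw [fderiv_const_mul (hsm.differentiableAt _ _ p)]
    rfl
  antisymm x y := by
    simp only [(halt _).antisymm x y]
    rw [fderiv_fun_neg]
    rfl

/-- The exterior derivative of a differential 2-form is a 3-form. -/
lemma isAlt3_d2 {ω : V → V → V → ℝ} (halt : ∀ p, IsAlt2 (ω p)) (hsm : Smooth2 ω) (p : V) :
    IsAlt3 (d2 ω p) where
  add_left x x' y z := by
    have h := isAlt2_fderiv halt hsm p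
    simp only [d2, map_add, (h _).add_left]
    ring
  smul_left c x y z := by
    have h := isAlt2_fderiv halt hsm p
    simp only [d2, map_smul, (h _).smul_left, smul_eq_mul]
    ring
  antisymm_left x y z := by
    have h := (isAlt2_fderiv halt hsm p z).antisymm x y
    simp only [d2] at h ⊢
    linarith
  antisymm_right x y z := by
    have h := (isAlt2_fderiv halt hsm p x).antisymm y z
    simp only [d2] at h ⊢
    linarith

lemma isAlt2_Omega : IsAlt2 Omega where
  add_left x x' y := by simp only [Omega, Pi.add_apply]; ring
  smul_left c x y := by simp only [Omega, Pi.smul_apply, smul_eq_mul]; ring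
  antisymm x y := by simp only [Omega]; ring

lemma IsAlt2.add_mul {ω η : V → V → ℝ} (hω : IsAlt2 ω) (hη : IsAlt2 η) (c : ℝ) :
    IsAlt2 fun x y => ω x y + c * η x y where
  add_left x x' y := by simp only [hω.add_left, hη.add_left]; ring
  smul_left a x y := by simp only [hω.smul_left, hη.smul_left]; ring
  antisymm x y := by simp only [hω.antisymm x y, hη.antisymm x y]; ring

/-- `⊥ d(ω + μΩ) = ⊥ dω + dμ`. -/
lemma perpThree_d2_add_mul_Omega {ω : V → V → V → ℝ} (hsm : Smooth2 ω) {μ : V → ℝ} {p : V}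
    (hμ : DifferentiableAt ℝ μ p) (x : V) :
    perpThree (d2 (fun q u v => ω q u v + μ q * Omega u v) p) x =
      perpThree (d2 ω p) x + fderiv ℝ μ p x := by
  have hd : ∀ u v w, fderiv ℝ (fun q => ω q u v + μ q * Omega u v) p w =
      fderiv ℝ (fun q => ω q u v) p w + fderiv ℝ μ p w * Omega u v := fun u v w => by
    rw [fderiv_fun_add (hsm.differentiableAt _ _ p) (hμ.mul_const _), fderiv_mul_const hμ]
    simp [mul_comm]
  have hx : fderiv ℝ μ p x = x 0 * fderiv ℝ μ p (e 0) + x 1 * fderiv ℝ μ p (e 1) +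
      x 2 * fderiv ℝ μ p (e 2) + x 3 * fderiv ℝ μ p (e 3) := by
    conv_lhs => rw [eq_sum_smul_e x]
    simp only [map_add, map_smul, smul_eq_mul]
  simp only [perpThree, d2, hd]
  rw [hx]
  simp only [Omega, e, Pi.single_apply, Fin.reduceEq, if_true, if_false]
  ring

/-- Poincaré lemma for smooth 1-forms on `ℝ⁴`. -/
lemma exists_primitive_of_d1_eq_zero {α : V → V →L[ℝ] ℝ} (hα : ContDiff ℝ (⊤ : ℕ∞) α)
    (hd : ∀ p x y, d1 (fun q => α q) p x y = 0) :
    ∃ f : V → ℝ, ContDiff ℝ (⊤ : ℕ∞) f ∧ fderiv ℝ f = α := by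
  have hdiff : Differentiable ℝ α := hα.differentiable (by simp)
  have happ : ∀ p x y, fderiv ℝ (fun q => α q y) p x = fderiv ℝ α p x y := fun p x y => by
    rw [fderiv_clm_apply (hdiff p) (differentiableAt_const y)]
    simp
  obtain ⟨f, hf⟩ := convex_univ.exists_forall_hasFDerivAt_of_fderiv_symmetric isOpen_univ
    hdiff.differentiableOn fun p _ x y => by
      simpa only [d1, happ, sub_eq_zero] using hd p x y
  have hf' : fderiv ℝ f = α := funext fun p => (hf p trivial).fderiv
  exact ⟨f, contDiff_infty_iff_fderiv.2
    ⟨fun p => (hf p trivial).differentiableAt, hf'.symm ▸ hα⟩, hf'⟩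

/-- The differential of a smooth function is closed: `d(df) = 0`. -/
lemma d1_d0 {f : V → ℝ} (hf : ContDiff ℝ (⊤ : ℕ∞) f) (p x y : V) : d1 (d0 f) p x y = 0 := by
  have hdiff : Differentiable ℝ (fderiv ℝ f) :=
    (contDiff_infty_iff_fderiv.1 hf).2.differentiable (by simp)
  have happ : ∀ x y, fderiv ℝ (fun q => fderiv ℝ f q y) p x = fderiv ℝ (fderiv ℝ f) p x y :=
    fun x y => by
      rw [fderiv_clm_apply (hdiff p) (differentiableAt_const y)]
      simp
  have hsymm : IsSymmSndFDerivAt ℝ f p :=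
    hf.contDiffAt.isSymmSndFDerivAt (by
      rw [minSmoothness_of_isRCLikeNormedField]
      exact WithTop.coe_le_coe.2 (le_top (a := (2 : ℕ∞))))
  simp only [d1, d0, happ, hsymm x y, sub_self]

/-- `⊥ dω`, as a map into continuous linear forms. -/
lemma exists_contDiff_perpThree_d2 {ω : V → V → V → ℝ} (halt : ∀ p, IsAlt2 (ω p))
    (hsm : Smooth2 ω) :
    ∃ α : V → V →L[ℝ] ℝ, ContDiff ℝ (⊤ : ℕ∞) α ∧ ∀ p x, α p x = perpThree (d2 ω p) x := by
  let L (p : V) : V →ₗ[ℝ] ℝ :=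
    { toFun := perpThree (d2 ω p)
      map_add' := fun x y => by
        have h := isAlt2_fderiv halt hsm p
        simp only [perpThree, d2, map_add, (h _).add_right]
        ring
      map_smul' := fun c x => by
        have h := isAlt2_fderiv halt hsm p
        simp only [perpThree, d2, map_smul, (h _).smul_right, smul_eq_mul, RingHom.id_apply]
        ring }
  refine ⟨fun p => LinearMap.toContinuousLinearMap (L p), ?_, fun p x => rfl⟩
  have hD : ∀ u v w, ContDiff ℝ (⊤ : ℕ∞) fun p => fderiv ℝ (fun q => ω q u v) p w :=
    fun u v w => (contDiff_infty_iff_fderiv.1 (hsm u v)).2.clm_apply contDiff_const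
  rw [contDiff_clm_apply_iff]
  intro x
  change ContDiff ℝ _ fun p => perpThree (d2 ω p) x
  exact (((hD _ _ _).sub (hD _ _ _)).add (hD _ _ _)).add
    (((hD _ _ _).sub (hD _ _ _)).add (hD _ _ _))

/-- a smooth 2-form `ω` on ℝ⁴ satisfies `d(⊥dω) = 0` (divergent type)
iff there is a smooth function `μ` with `d(ω + μΩ) = 0`. -/
theorem divergent_type_iff_exists_mu (ω : V → V → V → ℝ)
    (halt : ∀ p, IsAlt2 (ω p)) (hsm : Smooth2 ω) :
    (∀ p x y : V, d1 (fun q => perpThree (d2 ω q)) p x y = 0) ↔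
      ∃ μ : V → ℝ, ContDiff ℝ (⊤ : ℕ∞) μ ∧
        ∀ p x y z : V, d2 (fun q u v => ω q u v + μ q * Omega u v) p x y z = 0 := by
  constructor
  · intro hE
    obtain ⟨α, hα, hαeq⟩ := exists_contDiff_perpThree_d2 halt hsm
    obtain ⟨f, hf, hfα⟩ := exists_primitive_of_d1_eq_zero hα fun p x y => by
      simpa only [d1, hαeq] using hE p x y
    refine ⟨fun q => -f q, hf.neg, fun p => ?_⟩
    refine (isAlt3_d2 (fun q => (halt q).add_mul isAlt2_Omega _) (fun u v => (hsm u v).add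
      (hf.neg.mul contDiff_const)) p).eq_zero_of_perpThree_eq_zero fun x => ?_
    rw [perpThree_d2_add_mul_Omega hsm (hf.neg.differentiable (by simp) p), ← hαeq, ← hfα,
      fderiv_fun_neg]
    exact add_neg_cancel _
  · rintro ⟨μ, hμ, hclosed⟩ p x y
    have hperp : (fun q => perpThree (d2 ω q)) = d0 fun q => -μ q := by
      funext q z
      have h := perpThree_d2_add_mul_Omega hsm (hμ.differentiable (by simp) q) z
      simp only [perpThree, hclosed] at h
      rw [d0, fderiv_fun_neg, neg_apply]
      simp only [perpThree]
      linarith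
    rw [hperp]
    exact d1_d0 hμ.neg p x y

end
end

section
/- Let ω be an alternating 2-form on ℝ⁴, Θ = ω − iΩ and Φ = exp(Θ) = 1 + Θ + ½Θ∧Θ. A mixed-degree complex form of the shape (θ − (i/2)·(⊥θ))∧Φ, with θ a complex alternating 2-covector, is real (equal to its complex conjugate) if and only if it can be written as (θ₀ + a·(iΩ + 1))∧Φ for some real primitive 2-covector θ₀ and some real number a. In other words, the real part U₀^ℝ of U₀ = {(θ − (i/2)⊥θ)∧Φ : θ ∈ Λ²(ℝ⁴)*⊗ℂ} equals {(θ₀ + a(iΩ + 1))∧Φ : θ₀ primitive real, a ∈ ℝ}. -/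
noncomputable section

theorem bilin_expand {k : Type*} [CommRing k] {B : (Fin 4 → k) → (Fin 4 → k) → k}
    (hadd : ∀ x x' y, B (x + x') y = B x y + B x' y)
    (hsmul : ∀ (c : k) (x y), B (c • x) y = c * B x y)
    (hanti : ∀ x y, B x y = -B y x) (x y : Fin 4 → k) :
    B x y = ∑ i, ∑ j, x i * y j * B (Pi.single i 1) (Pi.single j 1) := by
  let L : (Fin 4 → k) →ₗ[k] (Fin 4 → k) →ₗ[k] k := LinearMap.mk₂ k B hadd hsmul
    (fun u v w => by rw [hanti u (v + w), hadd, hanti v u, hanti w u]; ring)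
    (fun c u v => by rw [hanti u (c • v), hsmul, hanti v u, smul_eq_mul]; ring)
  have key : ∀ u v, B u v = L u v := fun _ _ => rfl
  simp only [key]
  conv_lhs => rw [pi_eq_sum_univ' x, pi_eq_sum_univ' y]
  simp only [map_sum, LinearMap.sum_apply, map_smul, LinearMap.smul_apply, smul_eq_mul,
    Finset.mul_sum]
  rw [Finset.sum_comm]
  refine Finset.sum_congr rfl fun i _ => Finset.sum_congr rfl fun j _ => ?_
  rw [← mul_assoc, mul_comm (y _) (x _)]

theorem IsAlt2.expand {θ : V → V → ℝ} (h : IsAlt2 θ) (x y : V) :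
    θ x y = ∑ i, ∑ j, x i * y j * θ (e i) (e j) :=
  bilin_expand h.add_left h.smul_left h.antisymm x y

theorem IsAlt2C.expand {θ : Vc → Vc → ℂ} (h : IsAlt2C θ) (x y : Vc) :
    θ x y = ∑ i, ∑ j, x i * y j * θ (ec i) (ec j) :=
  bilin_expand h.add_left h.smul_left h.antisymm x y

/-- A 2-form with antisymmetric coefficient matrix and vanishing contraction with the Poisson
bivector is primitive. -/
theorem wedge22_symplectic_eq_zero {k : Type*} [Field k] [CharZero k] (b : Fin 4 → Fin 4 → k)
    (hb : ∀ i j, b i j = -b j i) (hp : b 0 2 + b 1 3 = 0) (x y z w : Fin 4 → k) :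
    wedge22 (fun x y : Fin 4 → k => ∑ i, ∑ j, x i * y j * b i j)
      (fun x y : Fin 4 → k => x 0 * y 2 - x 2 * y 0 + x 1 * y 3 - x 3 * y 1) x y z w = 0 := by
  have hd : ∀ i, b i i = 0 := fun i => self_eq_neg.mp (hb i i)
  have h13 : b 1 3 = -b 0 2 := by linear_combination hp
  simp only [wedge22, Fin.sum_univ_four, hd, hb 1 0, hb 2 0, hb 3 0, hb 2 1, hb 3 1, hb 3 2, h13]
  ring

theorem cx2_cconj (θ : V → V → ℝ) (x y : Vc) :
    cx2 θ (cconj x) (cconj y) = starRingEnd ℂ (cx2 θ x y) := by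
  simp [cx2, cconj]

theorem OmegaC_cconj (x y : Vc) :
    OmegaC (cconj x) (cconj y) = starRingEnd ℂ (OmegaC x y) := by
  simp [OmegaC, cconj]

theorem perpTwo_eq_zero_of_primitive {θ : V → V → ℝ}
    (hp : ∀ x y z w : V, wedge22 θ Omega x y z w = 0) : perpTwo θ = 0 := by
  have h := hp (e 0) (e 2) (e 1) (e 3)
  simp [wedge22, Omega, e] at h
  simp only [perpTwo, e]
  linarith

theorem IsAlt2.primitive_of_perpTwo_eq_zero {θ : V → V → ℝ}
    (hθ : IsAlt2 θ) (hp : perpTwo θ = 0) (x y z w : V) : wedge22 θ Omega x y z w = 0 := by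
  rw [show θ = _ from funext₂ hθ.expand]
  exact wedge22_symplectic_eq_zero (fun i j => θ (e i) (e j)) (fun _ _ => hθ.antisymm _ _) hp x y z w

theorem IsAlt2.wedge22_cx2_OmegaC {θ : V → V → ℝ}
    (hθ : IsAlt2 θ) (hp : perpTwo θ = 0) (x y z w : Vc) :
    wedge22 (cx2 θ) OmegaC x y z w = 0 :=
  wedge22_symplectic_eq_zero (fun i j => (θ (e i) (e j) : ℂ))
    (fun i j => by rw [hθ.antisymm]; push_cast; rfl) (by exact_mod_cast hp) x y z w

theorem IsAlt2.isAlt2C_cx2_add {θ : V → V → ℝ} (hθ : IsAlt2 θ) (c : ℂ) :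
    IsAlt2C fun x y => cx2 θ x y + c * OmegaC x y where
  add_left x x' y := by simp only [cx2, OmegaC, Fin.sum_univ_four, Pi.add_apply]; ring
  smul_left r x y := by
    simp only [cx2, OmegaC, Fin.sum_univ_four, Pi.smul_apply, smul_eq_mul]; ring
  antisymm x y := by
    have h : cx2 θ x y = -cx2 θ y x := by
      simp only [cx2]
      rw [Finset.sum_comm, ← Finset.sum_neg_distrib]
      refine Finset.sum_congr rfl fun i _ => ?_
      rw [← Finset.sum_neg_distrib]
      refine Finset.sum_congr rfl fun j _ => ?_
      rw [hθ.antisymm]; push_cast; ring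
    simp only [h, OmegaC]; ring

theorem cx2_ec (θ : V → V → ℝ) (i j : Fin 4) : cx2 θ (ec i) (ec j) = θ (e i) (e j) := by
  simp [cx2, ec, Pi.single_apply]

theorem perpTwoC_cx2_add (θ : V → V → ℝ) (c : ℂ) :
    perpTwoC (fun x y => cx2 θ x y + c * OmegaC x y) = perpTwo θ + 2 * c := by
  simp only [perpTwoC, perpTwo, cx2_ec]
  simp [OmegaC, ec]
  ring

/-- The real part of a complex 2-form, restricted to real vectors. -/
def rePart (θ : Vc → Vc → ℂ) : V → V → ℝ :=
  fun x y => (θ (fun i => (x i : ℂ)) (fun i => (y i : ℂ))).re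

theorem IsAlt2C.isAlt2_rePart {θ : Vc → Vc → ℂ} (hθ : IsAlt2C θ) : IsAlt2 (rePart θ) where
  add_left x x' y := by
    simp only [rePart]
    rw [← Complex.add_re, ← hθ.add_left]
    congr 2
    ext i
    simp
  smul_left c x y := by
    simp only [rePart]
    rw [← Complex.re_ofReal_mul, ← hθ.smul_left]
    congr 2
    ext i
    simp
  antisymm x y := by simp only [rePart]; rw [hθ.antisymm, Complex.neg_re]

theorem ofReal_e (i : Fin 4) : (fun j => (e i j : ℂ)) = ec i := by
  ext j
  simp [e, ec, Pi.single_apply, apply_ite Complex.ofReal]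

theorem cconj_ec (i : Fin 4) : cconj (ec i) = ec i := by
  ext j
  simp [cconj, ec, Pi.single_apply]

/-- the real part of `U₀ = {(θ - (i/2)⊥θ) ∧ Φ}` is exactly
`{(θ₀ + a(iΩ + 1)) ∧ Φ : θ₀ primitive real, a ∈ ℝ}`. -/
theorem U0_real_description (ω : V → V → ℝ) (hω : IsAlt2 ω) :
    {A : Mixed | (∃ θ : Vc → Vc → ℂ, IsAlt2C θ ∧
        A = wedgeM ⟨-(Complex.I / 2) * perpTwoC θ, 0, θ, 0, 0⟩ (PhiM ω)) ∧ conjM A = A}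
      = {A : Mixed | ∃ (θ₀ : V → V → ℝ) (a : ℝ), IsAlt2 θ₀ ∧
          (∀ x y z w : V, wedge22 θ₀ Omega x y z w = 0) ∧
          A = wedgeM
            ⟨(a : ℂ), 0, fun x y => cx2 θ₀ x y + (a : ℂ) * (Complex.I * OmegaC x y), 0, 0⟩
            (PhiM ω)} := by
  ext A
  constructor
  · rintro ⟨⟨θ, hθ, rfl⟩, hreal⟩
    have h0 := congrArg Mixed.c0 hreal
    simp only [conjM, wedgeM, PhiM, mul_one] at h0
    obtain ⟨a, ha⟩ := Complex.conj_eq_iff_real.mp h0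
    have h2 : ∀ i j, starRingEnd ℂ (θ (ec i) (ec j) - a * (Complex.I * OmegaC (ec i) (ec j)))
        = θ (ec i) (ec j) - a * (Complex.I * OmegaC (ec i) (ec j)) := fun i j => by
      have h := congrFun (congrFun (congrArg Mixed.c2 hreal) (ec i)) (ec j)
      simp only [conjM, wedgeM, PhiM, ha, cconj_ec, wedge11, ThetaM, Pi.zero_apply, cx2_ec, map_add,
        map_sub, map_mul, map_one, map_zero, Complex.conj_ofReal] at h ⊢
      linear_combination h
    have hΩ : ∀ i j, OmegaC (ec i) (ec j) = Omega (e i) (e j) := fun i j => by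
      simp only [← ofReal_e, OmegaC, Omega]; push_cast; rfl
    have hcoef : ∀ i j, θ (ec i) (ec j)
        = rePart θ (e i) (e j) + a * (Complex.I * OmegaC (ec i) (ec j)) := fun i j => by
      have h := Complex.conj_eq_iff_re.mp (h2 i j)
      have hre : (θ (ec i) (ec j) - a * (Complex.I * OmegaC (ec i) (ec j))).re
          = rePart θ (e i) (e j) := by
        simp [rePart, ofReal_e, hΩ]
      rw [hre] at h
      linear_combination -h
    have hθ_eq : θ = fun x y => cx2 (rePart θ) x y + a * Complex.I * OmegaC x y := by
      have hR := hθ.isAlt2_rePart.isAlt2C_cx2_add (a * Complex.I)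
      funext x y
      rw [hθ.expand, hR.expand]
      simp only [hcoef, cx2_ec, mul_assoc]
    have hperp : perpTwo (rePart θ) = 0 := by
      have h := perpTwoC_cx2_add (rePart θ) (a * Complex.I)
      rw [← hθ_eq] at h
      rw [h] at ha
      have h' : (Complex.I / 2) * (perpTwo (rePart θ) : ℂ) = 0 := by
        linear_combination -ha - (a : ℂ) * Complex.I_mul_I
      simpa using h'
    refine ⟨rePart θ, a, hθ.isAlt2_rePart,
      hθ.isAlt2_rePart.primitive_of_perpTwo_eq_zero hperp, ?_⟩
    rw [ha]
    simp only [← mul_assoc, ← hθ_eq]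
  · rintro ⟨θ₀, a, hθ₀, hprim, rfl⟩
    have hperp := perpTwo_eq_zero_of_primitive hprim
    refine ⟨⟨_, hθ₀.isAlt2C_cx2_add (a * Complex.I), ?_⟩, ?_⟩
    · rw [perpTwoC_cx2_add, hperp]
      have : -(Complex.I / 2) * (((0 : ℝ) : ℂ) + 2 * (a * Complex.I)) = a := by
        push_cast
        linear_combination -(a : ℂ) * Complex.I_mul_I
      simp only [this, mul_assoc]
    · simp only [conjM, wedgeM, PhiM, Mixed.mk.injEq]
      refine ⟨by simp, by simp, ?_, by simp [wedge12], ?_⟩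
      · funext x y
        simp only [ThetaM, wedge11, cx2_cconj, OmegaC_cconj, Pi.zero_apply, map_add, map_sub,
          map_mul, map_one, map_zero, Complex.conj_conj, Complex.conj_ofReal, Complex.conj_I]
        ring
      · funext x y z w
        have hw := hθ₀.wedge22_cx2_OmegaC hperp x y z w
        simp only [ThetaM, wedge13, wedge31, wedge22, cx2_cconj, OmegaC_cconj, Pi.zero_apply,
          map_add, map_sub, map_mul, map_one, map_zero, map_div₀, map_ofNat, Complex.conj_conj,
          Complex.conj_ofReal, Complex.conj_I] at hw ⊢
        linear_combination 2 * Complex.I * hw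

end
end

section
/- Let ω = ω₀ + λΩ be a smooth closed differential 2-form on ℝ⁴ with ω₀ pointwise primitive, B = λ·Id − A₀, and let f, g be smooth functions with d(fω + gΩ) = 0. Then dg = −df∘B, so the Hamiltonian vector fields satisfy X_g = −B X_f; moreover at every point both Ω and ω vanish on the plane spanned by X_f and X_g. Consequently, for any c ∈ ℂ, at each point of the level set L_c = (f+ig)^{-1}(c) where df and dg are linearly independent, the tangent plane span{X_f, X_g} of L_c is Lagrangian for both Ω and ω, i.e. L_c is a generalized solution of Δ_ω = 0. -/
noncomputable section

/-- The form `Ω` is antisymmetric. -/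
lemma Omega_antisymm (x y : V) : Omega x y = -Omega y x := by
  simp only [Omega]; ring

lemma Omega_add_left (x x' y : V) : Omega (x + x') y = Omega x y + Omega x' y := by
  simp only [Omega, Pi.add_apply]; ring

lemma Omega_sub_left (x x' y : V) : Omega (x - x') y = Omega x y - Omega x' y := by
  simp only [Omega, Pi.sub_apply]; ring

lemma Omega_neg_left (x y : V) : Omega (-x) y = -Omega x y := by
  simp only [Omega, Pi.neg_apply]; ring

lemma Omega_smul_left (c : ℝ) (x y : V) : Omega (c • x) y = c * Omega x y := by
  simp only [Omega, Pi.smul_apply, smul_eq_mul]; ring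

/-- The form `Ω` is nondegenerate. -/
lemma eq_of_Omega_eq {u v : V} (h : ∀ y, Omega u y = Omega v y) : u = v := by
  have h0 := h (e 0)
  have h1 := h (e 1)
  have h2 := h (e 2)
  have h3 := h (e 3)
  simp [Omega, e] at h0 h1 h2 h3
  ext i
  fin_cases i <;> simp <;> linarith

/-- Wedging with `Ω` is injective on 1-forms of `ℝ⁴`. -/
lemma eq_zero_of_wedge12_Omega_eq_zero (a : V →ₗ[ℝ] ℝ)
    (h : ∀ x y z, wedge12 a Omega x y z = 0) : a = 0 := by
  refine (Pi.basisFun ℝ (Fin 4)).ext fun i => ?_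
  have h0 := h (e 0) (e 1) (e 3)
  have h1 := h (e 1) (e 0) (e 2)
  have h2 := h (e 2) (e 1) (e 3)
  have h3 := h (e 3) (e 0) (e 2)
  simp [wedge12, Omega, e] at h0 h1 h2 h3
  fin_cases i <;> simp [*]

/-- The Leibniz rule for a combination `f ω + g Ω` of a closed 2-form and the constant form `Ω`. -/
lemma d2_mul_add_mul_Omega {ω : V → V → V → ℝ} {f g : V → ℝ}
    (hω : ∀ x y, Differentiable ℝ fun p => ω p x y)
    (hclosed : ∀ p x y z, d2 ω p x y z = 0)
    (hf : Differentiable ℝ f) (hg : Differentiable ℝ g) (p x y z : V) :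
    d2 (fun q u v => f q * ω q u v + g q * Omega u v) p x y z
      = wedge12 (fderiv ℝ f p) (ω p) x y z + wedge12 (fderiv ℝ g p) Omega x y z := by
  have key : ∀ u v w, fderiv ℝ (fun q => f q * ω q u v + g q * Omega u v) p w
      = f p * fderiv ℝ (fun q => ω q u v) p w + fderiv ℝ f p w * ω p u v
        + fderiv ℝ g p w * Omega u v := by
    intro u v w
    rw [fderiv_fun_add ((hf p).fun_mul (hω u v p)) ((hg p).mul_const _),
      fderiv_fun_mul (hf p) (hω u v p), fderiv_mul_const (hg p)]
    simp
    ring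
  have hc := hclosed p x y z
  simp only [d2] at hc
  simp only [d2, key, wedge12]
  linear_combination f p * hc

/-- An antisymmetric form vanishes on the span of two vectors as soon as it vanishes on the
pair. -/
lemma IsAlt2.eq_zero_of_mem_span_pair {θ : V → V → ℝ} (hθ : IsAlt2 θ) {X Y : V}
    (h : θ X Y = 0) {v w : V} (hv : v ∈ Submodule.span ℝ ({X, Y} : Set V))
    (hw : w ∈ Submodule.span ℝ ({X, Y} : Set V)) : θ v w = 0 := by
  obtain ⟨a, b, rfl⟩ := Submodule.mem_span_pair.1 hv
  obtain ⟨c, d, rfl⟩ := Submodule.mem_span_pair.1 hw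
  have hX := hθ.antisymm X X
  have hY := hθ.antisymm Y Y
  have hYX := hθ.antisymm Y X
  have hr : ∀ u, θ u (c • X + d • Y) = c * θ u X + d * θ u Y := fun u => by
    rw [hθ.antisymm, hθ.add_left, hθ.smul_left, hθ.smul_left, hθ.antisymm X u, hθ.antisymm Y u]
    ring
  rw [hθ.add_left, hθ.smul_left, hθ.smul_left, hr, hr]
  linear_combination (a * c / 2) * hX + (b * d / 2) * hY + b * c * hYX + (a * d - b * c) * h

lemma isAlt2_Omega_s14 : IsAlt2 Omega := ⟨Omega_add_left, Omega_smul_left, Omega_antisymm⟩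

/-- if `d(fω + gΩ) = 0` then `dg = -df∘B`, `X_g = -B X_f`, the plane
spanned by `X_f, X_g` is Lagrangian for both `Ω` and `ω` at every point; in particular
the regular level sets of `f + ig` are generalized solutions of `Δ_ω = 0`. -/
theorem conjugate_pair_gives_generalized_solutions (ω₀ : V → V → V → ℝ)
    (halt : ∀ p, IsAlt2 (ω₀ p)) (hsm : Smooth2 ω₀)
    (hprim : ∀ p x y z w : V, wedge22 (ω₀ p) Omega x y z w = 0)
    (lam : V → ℝ) (hlam : ContDiff ℝ (⊤ : ℕ∞) lam)
    (A₀ : V → (V →ₗ[ℝ] V)) (hA : ∀ p X Y, ω₀ p X Y = Omega (A₀ p X) Y)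
    (B : V → (V →ₗ[ℝ] V)) (hB : ∀ p v, B p v = lam p • v - A₀ p v)
    (ω : V → V → V → ℝ) (hω : ∀ p x y, ω p x y = ω₀ p x y + lam p * Omega x y)
    (hclosed : ∀ p x y z, d2 ω p x y z = 0)
    (f g : V → ℝ) (hf : ContDiff ℝ (⊤ : ℕ∞) f) (hg : ContDiff ℝ (⊤ : ℕ∞) g)
    (hfg : ∀ p x y z, d2 (fun q u v => f q * ω q u v + g q * Omega u v) p x y z = 0)
    (Xf Xg : V → V)
    (hXf : ∀ p y, Omega (Xf p) y = fderiv ℝ f p y)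
    (hXg : ∀ p y, Omega (Xg p) y = fderiv ℝ g p y) :
    (∀ p x, fderiv ℝ g p x = - fderiv ℝ f p (B p x))
    ∧ (∀ p, Xg p = - B p (Xf p))
    ∧ (∀ p, ∀ v ∈ Submodule.span ℝ ({Xf p, Xg p} : Set V),
        ∀ w ∈ Submodule.span ℝ ({Xf p, Xg p} : Set V), Omega v w = 0 ∧ ω p v w = 0)
    ∧ ∀ (c : ℂ) (p : V), (f p : ℂ) + (g p : ℂ) * Complex.I = c →
        LinearIndependent ℝ ![fderiv ℝ f p, fderiv ℝ g p] →
        ∀ v ∈ Submodule.span ℝ ({Xf p, Xg p} : Set V),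
          ∀ w ∈ Submodule.span ℝ ({Xf p, Xg p} : Set V), Omega v w = 0 ∧ ω p v w = 0 := by
  have hB_symm : ∀ p x y, Omega (B p x) y = Omega x (B p y) := fun p x y => by
    rw [Omega_antisymm x, hB, hB, Omega_sub_left, Omega_sub_left, Omega_smul_left,
      Omega_smul_left, ← hA, ← hA, (halt p).antisymm y x, Omega_antisymm y x]
    ring
  have hω_diff : ∀ x y, Differentiable ℝ fun p => ω p x y := fun x y => by
    simp only [hω]
    exact ((hsm x y).differentiable (by simp)).add
      ((hlam.differentiable (by simp)).mul_const _)
  have hω_alt : ∀ p, IsAlt2 (ω p) := fun p =>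
    ⟨fun x x' y => by rw [hω, hω, hω, (halt p).add_left, Omega_add_left]; ring,
     fun c x y => by rw [hω, hω, (halt p).smul_left, Omega_smul_left]; ring,
     fun x y => by rw [hω, hω, (halt p).antisymm, Omega_antisymm]; ring⟩
  have hdg : ∀ p x, fderiv ℝ g p x = -fderiv ℝ f p (B p x) := by
    intro p x
    have h0 : ((fderiv ℝ g p : V →ₗ[ℝ] ℝ) + (fderiv ℝ f p : V →ₗ[ℝ] ℝ) ∘ₗ B p) = 0 := by
      refine eq_zero_of_wedge12_Omega_eq_zero _ fun x y z => ?_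
      have h := hfg p x y z
      rw [d2_mul_add_mul_Omega hω_diff hclosed (hf.differentiable (by simp))
        (hg.differentiable (by simp))] at h
      have hp := hprim p (Xf p) x y z
      have hfB : ∀ u, fderiv ℝ f p (B p u) = lam p * fderiv ℝ f p u - ω₀ p (Xf p) u :=
        fun u => by
          rw [← hXf, ← hB_symm, hB, Omega_sub_left, Omega_smul_left, hXf, ← hA]
      simp only [wedge12, wedge22, hω, hXf] at h hp
      simp only [wedge12, LinearMap.add_apply, LinearMap.comp_apply, ContinuousLinearMap.coe_coe,
        hfB]
      linear_combination h - hp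
    have := LinearMap.congr_fun h0 x
    simp only [LinearMap.add_apply, LinearMap.comp_apply, ContinuousLinearMap.coe_coe,
      LinearMap.zero_apply] at this
    linarith
  have hXgB : ∀ p, Xg p = -B p (Xf p) := fun p => eq_of_Omega_eq fun y => by
    rw [Omega_neg_left, hB_symm, hXf, hXg, hdg]
  have hspan : ∀ p, ∀ v ∈ Submodule.span ℝ ({Xf p, Xg p} : Set V),
      ∀ w ∈ Submodule.span ℝ ({Xf p, Xg p} : Set V), Omega v w = 0 ∧ ω p v w = 0 := by
    intro p v hv w hw
    have hΩ : Omega (Xf p) (Xg p) = 0 := by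
      have h1 := hB_symm p (Xf p) (Xf p)
      rw [Omega_antisymm, hXgB, Omega_neg_left]
      linarith [Omega_antisymm (Xf p) (B p (Xf p))]
    have hω₀ : ω₀ p (Xf p) (Xg p) = 0 := by
      have h1 := (halt p).antisymm (Xf p) (Xf p)
      have h2 := Omega_antisymm (A₀ p (Xf p)) (A₀ p (Xf p))
      have h3 := Omega_antisymm (Xf p) (A₀ p (Xf p))
      rw [hA] at h1
      rw [hA, Omega_antisymm, hXgB, hB, Omega_neg_left, Omega_sub_left,
        Omega_smul_left]
      linear_combination lam p * h3 - h2 / 2 - lam p * h1 / 2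
    exact ⟨isAlt2_Omega_s14.eq_zero_of_mem_span_pair hΩ hv hw,
      (hω_alt p).eq_zero_of_mem_span_pair (by rw [hω, hω₀, hΩ]; ring) hv hw⟩
  exact ⟨hdg, hXgB, hspan, fun _ p _ _ => hspan p⟩

end
end
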